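/- arXiv:2307.15844 — 2 statements merged into one kernel-verified Lean document; each statement's English description precedes it below -/
import Mathlib

section
/- Let X_1, …, X_m form a Markov chain on a tree G = (M, E), and let π = (π_1, …, π_k), 2 ≤ k ≤ m, be a partition of M each of whose atoms π_u is a connected subset of the tree G. Then I(π) ≥ min over edges (i,j) ∈ E of I(X_i ∧ X_j). -/
open Classical
open scoped BigOperators

noncomputable section

namespace MCT

variable {m : ℕ}

/-- Marginal pmf of the coordinates in `A`. -/
def marg (𝒳 : Fin m → Type) [∀ i, Fintype (𝒳 i)]
    (p : (∀ i, 𝒳 i) → ℝ) (A : Finset (Fin m)) (y : (i : A) → 𝒳 i.1) : ℝ :=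
  ∑ x : (i : Fin m) → 𝒳 i, if ∀ i : A, x i.1 = y i then p x else 0

/-- Shannon entropy (base 2) of the collection `X_A`. -/
def ent (𝒳 : Fin m → Type) [∀ i, Fintype (𝒳 i)]
    (p : (∀ i, 𝒳 i) → ℝ) (A : Finset (Fin m)) : ℝ :=
  -∑ y : (i : A) → 𝒳 i.1, marg 𝒳 p A y * Real.logb 2 (marg 𝒳 p A y)

/-- Mutual information I(X_A ∧ X_B). -/
def mutI (𝒳 : Fin m → Type) [∀ i, Fintype (𝒳 i)]
    (p : (∀ i, 𝒳 i) → ℝ) (A B : Finset (Fin m)) : ℝ :=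
  ent 𝒳 p A + ent 𝒳 p B - ent 𝒳 p (A ∪ B)

/-- Conditional mutual information I(X_A ∧ X_B | X_S). -/
def cmi (𝒳 : Fin m → Type) [∀ i, Fintype (𝒳 i)]
    (p : (∀ i, 𝒳 i) → ℝ) (A B S : Finset (Fin m)) : ℝ :=
  ent 𝒳 p (A ∪ S) + ent 𝒳 p (B ∪ S) - ent 𝒳 p (A ∪ B ∪ S) - ent 𝒳 p S

/-- `side G i j` = B(i←j): vertices connected to `j` by a path containing edge (i,j),
equivalently the vertices on `i`'s side once edge (i,j) is removed. -/
def side {V : Type*} [Fintype V] (G : SimpleGraph V) (i j : V) : Finset V :=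
  Finset.univ.filter fun k => (G.deleteEdges {s(i, j)}).Reachable k i

/-- Markov chain on a tree: for each edge (i,j), X_j ⊥ X_{B(i←j)\{i}} | X_i. -/
def IsMCT (𝒳 : Fin m → Type) [∀ i, Fintype (𝒳 i)] (G : SimpleGraph (Fin m))
    (p : (∀ i, 𝒳 i) → ℝ) : Prop :=
  ∀ i j : Fin m, G.Adj i j → cmi 𝒳 p {j} ((side G i j).erase i) {i} = 0

/-- A partition of {1,…,m} into nonempty pairwise disjoint atoms covering everything. -/
def IsPartition (π : Finset (Finset (Fin m))) : Prop :=
  (∀ a ∈ π, a.Nonempty) ∧ ((π : Set (Finset (Fin m))).PairwiseDisjoint id) ∧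
    π.sup id = Finset.univ

/-- I(π) = (1/(|π|−1))·[Σ_{a∈π} H(X_a) − H(X_M)]. -/
def cI (𝒳 : Fin m → Type) [∀ i, Fintype (𝒳 i)]
    (p : (∀ i, 𝒳 i) → ℝ) (π : Finset (Finset (Fin m))) : ℝ :=
  ((π.card : ℝ) - 1)⁻¹ * ((∑ a ∈ π, ent 𝒳 p a) - ent 𝒳 p Finset.univ)

/-- Shared information: minimum of I(π) over partitions with at least two atoms. -/
def SI (𝒳 : Fin m → Type) [∀ i, Fintype (𝒳 i)] (p : (∀ i, 𝒳 i) → ℝ) : ℝ :=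
  sInf {r | ∃ π : Finset (Finset (Fin m)), IsPartition π ∧ 2 ≤ π.card ∧ r = cI 𝒳 p π}

section ClassMass

variable {Ω : Type*} [Fintype Ω] {p : Ω → ℝ}

/-- Total mass of the equivalence class of `x`. -/
def classMass (p : Ω → ℝ) (r : Setoid Ω) (x : Ω) : ℝ :=
  ∑ u, if r u x then p u else 0

lemma classMass_congr (r : Setoid Ω) {x y : Ω} (h : r x y) :
    classMass p r x = classMass p r y := by
  refine Finset.sum_congr rfl fun u _ => ?_
  have : r u x ↔ r u y := ⟨fun hu => r.trans hu h, fun hu => r.trans hu (r.symm h)⟩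
  simp only [this]

lemma classMass_nonneg (hp : ∀ x, 0 ≤ p x) (r : Setoid Ω) (x : Ω) : 0 ≤ classMass p r x :=
  Finset.sum_nonneg fun u _ => by split_ifs <;> simp [hp]

lemma le_classMass (hp : ∀ x, 0 ≤ p x) (r : Setoid Ω) (x : Ω) : p x ≤ classMass p r x := by
  have := Finset.single_le_sum (f := fun u => if r u x then p u else 0)
    (fun u _ => by split_ifs <;> simp [hp]) (Finset.mem_univ x)
  simpa [classMass, r.refl x] using this

lemma sum_inter_class_le (hp : ∀ x, 0 ≤ p x) {A B C : Setoid Ω} (hA : A ≤ C) (hB : B ≤ C)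
    (u v : Ω) :
    (∑ x, if A u x ∧ B v x then p x / (classMass p (A ⊓ B) x * classMass p C x) else 0)
      ≤ if C v u then (classMass p C u)⁻¹ else 0 := by
  by_cases h : ∃ x, A u x ∧ B v x
  · obtain ⟨x₀, hu, hv⟩ := h
    have hC : C v u := C.trans (hB hv) (C.symm (hA hu))
    rw [if_pos hC]
    have key : (∑ x, if A u x ∧ B v x then
        p x / (classMass p (A ⊓ B) x * classMass p C x) else 0)
        = classMass p (A ⊓ B) x₀ / (classMass p (A ⊓ B) x₀ * classMass p C u) := by
      conv_rhs => rw [classMass, Finset.sum_div]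
      refine Finset.sum_congr rfl fun x _ => ?_
      by_cases hx : A u x ∧ B v x
      · have hx₀ : (A ⊓ B) x x₀ :=
          ⟨A.trans (A.symm hx.1) hu, B.trans (B.symm hx.2) hv⟩
        rw [if_pos hx, if_pos hx₀, classMass_congr _ hx₀, classMass_congr C (hA hx.1)]
        rfl
      · have hx₀ : ¬ (A ⊓ B) x x₀ := fun h =>
          hx ⟨A.trans hu (A.symm h.1), B.trans hv (B.symm h.2)⟩
        rw [if_neg hx, if_neg hx₀, zero_div]
    rw [key, ← div_div, div_eq_mul_inv _ (classMass p C u)]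
    exact mul_le_of_le_one_left (inv_nonneg.2 (classMass_nonneg hp C u)) (div_self_le_one _)
  · push Not at h
    rw [Finset.sum_eq_zero fun x _ => if_neg fun hx => h x hx.1 hx.2]
    split_ifs
    · exact inv_nonneg.2 (classMass_nonneg hp C u)
    · exact le_rfl

lemma sum_mul_classMass_ratio_le (hp : ∀ x, 0 ≤ p x) {A B C : Setoid Ω} (hA : A ≤ C)
    (hB : B ≤ C) :
    ∑ x, p x * (classMass p A x * classMass p B x / (classMass p (A ⊓ B) x * classMass p C x))
      ≤ ∑ x, p x := by
  calc _ = ∑ x, ∑ u, ∑ v, p u * (p v * if A u x ∧ B v x then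
          p x / (classMass p (A ⊓ B) x * classMass p C x) else 0) := by
        refine Finset.sum_congr rfl fun x _ => ?_
        generalize classMass p (A ⊓ B) x * classMass p C x = d
        rw [classMass, classMass, Finset.sum_mul_sum, Finset.sum_div, Finset.mul_sum]
        refine Finset.sum_congr rfl fun u _ => ?_
        rw [Finset.sum_div, Finset.mul_sum]
        refine Finset.sum_congr rfl fun v _ => ?_
        by_cases h₁ : A u x <;> by_cases h₂ : B v x <;> simp [h₁, h₂]
        ring
    _ = ∑ u, p u * ∑ v, p v * ∑ x, if A u x ∧ B v x then
          p x / (classMass p (A ⊓ B) x * classMass p C x) else 0 := by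
        rw [Finset.sum_comm]
        refine Finset.sum_congr rfl fun u _ => ?_
        rw [Finset.sum_comm, Finset.mul_sum]
        refine Finset.sum_congr rfl fun v _ => ?_
        rw [Finset.mul_sum, Finset.mul_sum]
    _ ≤ ∑ u, p u * ∑ v, p v * if C v u then (classMass p C u)⁻¹ else 0 := by
        refine Finset.sum_le_sum fun u _ => mul_le_mul_of_nonneg_left ?_ (hp u)
        exact Finset.sum_le_sum fun v _ =>
          mul_le_mul_of_nonneg_left (sum_inter_class_le hp hA hB u v) (hp v)
    _ = ∑ u, p u * (classMass p C u * (classMass p C u)⁻¹) := by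
        refine Finset.sum_congr rfl fun u _ => ?_
        generalize (classMass p C u)⁻¹ = c
        rw [classMass, Finset.sum_mul]
        simp only [mul_ite, mul_zero, ite_mul, zero_mul]
    _ ≤ ∑ u, p u :=
        Finset.sum_le_sum fun u _ => mul_le_of_le_one_right (hp u) mul_inv_le_one

/-- Submodularity of entropy, for the entropies of the quotients of `Ω` by `A`, `B`, `A ⊓ B` and
a common coarsening `C` of `A` and `B`. -/
lemma sum_mul_logb_classMass_submodular (hp : ∀ x, 0 ≤ p x) {A B C : Setoid Ω} (hA : A ≤ C)
    (hB : B ≤ C) :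
    ∑ x, p x * Real.logb 2 (classMass p A x) + ∑ x, p x * Real.logb 2 (classMass p B x) ≤
      ∑ x, p x * Real.logb 2 (classMass p (A ⊓ B) x) +
        ∑ x, p x * Real.logb 2 (classMass p C x) := by
  have h2 : 0 < Real.log 2 := Real.log_pos one_lt_two
  rw [← sub_nonpos, ← Finset.sum_add_distrib, ← Finset.sum_add_distrib,
    ← Finset.sum_sub_distrib]
  have key : ∀ x, p x * Real.logb 2 (classMass p A x) + p x * Real.logb 2 (classMass p B x) -
      (p x * Real.logb 2 (classMass p (A ⊓ B) x) + p x * Real.logb 2 (classMass p C x)) ≤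
      (p x * (classMass p A x * classMass p B x /
        (classMass p (A ⊓ B) x * classMass p C x)) - p x) / Real.log 2 := by
    intro x
    rcases (hp x).eq_or_lt with h0 | hpos
    · simp [← h0]
    have pos : ∀ r, 0 < classMass p r x := fun r => hpos.trans_le (le_classMass hp r x)
    have hlog := Real.log_le_sub_one_of_pos
      (div_pos (mul_pos (pos A) (pos B)) (mul_pos (pos (A ⊓ B)) (pos C)))
    rw [Real.log_div (mul_pos (pos A) (pos B)).ne' (mul_pos (pos (A ⊓ B)) (pos C)).ne',
      Real.log_mul (pos A).ne' (pos B).ne', Real.log_mul (pos (A ⊓ B)).ne' (pos C).ne'] at hlog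
    rw [le_div_iff₀ h2]
    have := mul_le_mul_of_nonneg_left hlog hpos.le
    simp only [Real.logb]
    field_simp
    linarith
  refine (Finset.sum_le_sum fun x _ => key x).trans ?_
  rw [← Finset.sum_div, Finset.sum_sub_distrib]
  exact div_nonpos_of_nonpos_of_nonneg
    (sub_nonpos.2 (sum_mul_classMass_ratio_le hp hA hB)) h2.le

end ClassMass

section Entropy

variable (𝒳 : Fin m → Type)

/-- Agreement on the coordinates in `A`. -/
def agreeOn (A : Finset (Fin m)) : Setoid (∀ i, 𝒳 i) where
  r x y := ∀ i ∈ A, x i = y i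
  iseqv := ⟨fun _ _ _ => rfl, fun h i hi => (h i hi).symm,
    fun h₁ h₂ i hi => (h₁ i hi).trans (h₂ i hi)⟩

lemma agreeOn_anti {A B : Finset (Fin m)} (h : A ⊆ B) : agreeOn 𝒳 B ≤ agreeOn 𝒳 A :=
  fun _ _ hxy i hi => hxy i (h hi)

lemma agreeOn_union (A B : Finset (Fin m)) : agreeOn 𝒳 (A ∪ B) = agreeOn 𝒳 A ⊓ agreeOn 𝒳 B := by
  ext x y
  refine ⟨fun h => ⟨fun i hi => h i (Finset.mem_union_left _ hi),
    fun i hi => h i (Finset.mem_union_right _ hi)⟩, fun h i hi => ?_⟩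
  exact (Finset.mem_union.1 hi).elim (h.1 i) (h.2 i)

variable [∀ i, Fintype (𝒳 i)] {p : (∀ i, 𝒳 i) → ℝ}

lemma ent_eq_sum_classMass (A : Finset (Fin m)) :
    ent 𝒳 p A = -∑ x, p x * Real.logb 2 (classMass p (agreeOn 𝒳 A) x) := by
  have hmarg : ∀ x, marg 𝒳 p A (fun i => x i.1) = classMass p (agreeOn 𝒳 A) x := by
    intro x
    refine Finset.sum_congr rfl fun u _ => ?_
    have : (∀ i : A, u i.1 = x i.1) ↔ agreeOn 𝒳 A u x :=
      ⟨fun h i hi => h ⟨i, hi⟩, fun h i => h i.1 i.2⟩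
    simp only [this]
  rw [ent, neg_inj]
  calc _ = ∑ y : (i : A) → 𝒳 i.1, ∑ x, if (fun i : A => x i.1) = y then
          p x * Real.logb 2 (marg 𝒳 p A y) else 0 := by
        refine Finset.sum_congr rfl fun y _ => ?_
        conv_lhs => enter [1]; rw [marg]
        rw [Finset.sum_mul]
        simp only [ite_mul, zero_mul, funext_iff]
    _ = _ := by
        rw [Finset.sum_comm]
        simp [hmarg]

lemma ent_submodular (hp : ∀ x, 0 ≤ p x) (A B : Finset (Fin m)) :
    ent 𝒳 p (A ∪ B) + ent 𝒳 p (A ∩ B) ≤ ent 𝒳 p A + ent 𝒳 p B := by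
  have := sum_mul_logb_classMass_submodular hp
    (agreeOn_anti 𝒳 (A.inter_subset_left (s₂ := B))) (agreeOn_anti 𝒳 A.inter_subset_right)
  simp only [ent_eq_sum_classMass, agreeOn_union]
  linarith

lemma mutI_comm (A B : Finset (Fin m)) : mutI 𝒳 p A B = mutI 𝒳 p B A := by
  rw [mutI, mutI, Finset.union_comm, add_comm (ent 𝒳 p A)]

lemma mutI_mono_left (hp : ∀ x, 0 ≤ p x) {A A' B : Finset (Fin m)} (h : A ⊆ A')
    (hd : Disjoint A' B) : mutI 𝒳 p A B ≤ mutI 𝒳 p A' B := by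
  have := ent_submodular 𝒳 hp A' (A ∪ B)
  rw [Finset.inter_union_distrib_left, Finset.inter_eq_right.2 h,
    Finset.disjoint_iff_inter_eq_empty.1 hd, Finset.union_empty,
    ← Finset.union_assoc, Finset.union_eq_left.2 h] at this
  simp only [mutI]
  linarith

lemma mutI_mono (hp : ∀ x, 0 ≤ p x) {A A' B B' : Finset (Fin m)} (hA : A ⊆ A') (hB : B ⊆ B')
    (hd : Disjoint A' B') : mutI 𝒳 p A B ≤ mutI 𝒳 p A' B' := by
  refine (mutI_mono_left 𝒳 hp hA (hd.mono_right hB)).trans ?_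
  rw [mutI_comm, mutI_comm 𝒳 A']
  exact mutI_mono_left 𝒳 hp hB hd.symm

/-- In a connected graph the atoms of a partition can be merged one at a time along edges, each
merge costing at least a common lower bound `c` on the mutual information across edges. -/
lemma exists_subpartition_ent_add_le (hp : ∀ x, 0 ≤ p x) {G : SimpleGraph (Fin m)}
    (hG : G.Connected) {c : ℝ} (hc : ∀ i j, G.Adj i j → c ≤ mutI 𝒳 p {i} {j})
    {π : Finset (Finset (Fin m))} (hpart : IsPartition π) (n : ℕ) (hn : n + 1 ≤ π.card) :
    ∃ S ⊆ π, S.card = n + 1 ∧ ent 𝒳 p (S.sup id) + n * c ≤ ∑ a ∈ S, ent 𝒳 p a := by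
  obtain ⟨hne, hdisj, hsup⟩ := hpart
  induction n with
  | zero =>
    obtain ⟨a, ha⟩ := Finset.card_pos.1 hn
    exact ⟨{a}, by simpa using ha, by simp⟩
  | succ n ih =>
    obtain ⟨S, hS, hcard, hle⟩ := ih (by omega)
    have hdisjS : ∀ a ∈ π, a ∉ S → Disjoint (S.sup id) a := fun a ha haS =>
      Finset.disjoint_sup_left.2 fun b hb => hdisj (hS hb) ha fun h => haS (h ▸ hb)
    obtain ⟨b, hb⟩ := Finset.card_pos.1 (by omega : 0 < S.card)
    obtain ⟨x, hx⟩ := hne b (hS hb)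
    obtain ⟨d, hd, hdS⟩ := Finset.exists_mem_notMem_of_card_lt_card (s := S) (t := π) (by omega)
    obtain ⟨y, hy⟩ := hne d hd
    obtain ⟨w⟩ := hG.preconnected x y
    obtain ⟨e, -, he₁, he₂⟩ := w.exists_boundary_dart (S.sup id : Finset (Fin m))
      (Finset.mem_coe.2 (Finset.mem_sup.2 ⟨b, hb, hx⟩))
      (fun h => Finset.disjoint_left.1 (hdisjS d hd hdS) (Finset.mem_coe.1 h) hy)
    obtain ⟨a, ha, hea⟩ := Finset.mem_sup.1 (hsup ▸ Finset.mem_univ e.snd)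
    have haS : a ∉ S := fun h => he₂ (Finset.mem_coe.2 (Finset.mem_sup.2 ⟨a, h, hea⟩))
    refine ⟨insert a S, Finset.insert_subset ha hS, by
      rw [Finset.card_insert_of_notMem haS, hcard], ?_⟩
    have hmut := (hc _ _ e.adj).trans (mutI_mono 𝒳 hp
      (Finset.singleton_subset_iff.2 (Finset.mem_coe.1 he₁))
      (Finset.singleton_subset_iff.2 hea) (hdisjS a ha haS))
    rw [mutI, id_eq] at hmut
    rw [Finset.sum_insert haS, Finset.sup_insert, id, Finset.sup_eq_union, Finset.union_comm]
    push_cast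
    linarith

end Entropy

/-- For an MCT and any partition π of M (with 2 ≤ |π| ≤ m atoms) all of
whose atoms are connected in the tree, I(π) ≥ min over edges (i,j) of I(X_i ∧ X_j). -/
theorem cI_ge_min_edge_of_connected_atoms
    {m : ℕ} (hm : 2 ≤ m) (𝒳 : Fin m → Type) [∀ i, Fintype (𝒳 i)]
    (p : (∀ i, 𝒳 i) → ℝ) (hp0 : ∀ x, 0 ≤ p x) (hp1 : ∑ x, p x = 1)
    (G : SimpleGraph (Fin m)) (hG : G.IsTree) (hMCT : IsMCT 𝒳 G p)
    (π : Finset (Finset (Fin m))) (hpart : IsPartition π) (hk : 2 ≤ π.card)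
    (hconn : ∀ a ∈ π, (G.induce (↑a : Set (Fin m))).Connected) :
    sInf {r | ∃ i j : Fin m, G.Adj i j ∧ r = mutI 𝒳 p {i} {j}} ≤ cI 𝒳 p π := by
  have hfin : {r | ∃ i j : Fin m, G.Adj i j ∧ r = mutI 𝒳 p {i} {j}}.Finite :=
    (Set.finite_range fun q : Fin m × Fin m => mutI 𝒳 p {q.1} {q.2}).subset
      fun r ⟨i, j, _, hr⟩ => ⟨(i, j), hr.symm⟩
  obtain ⟨S, hS, hcard, hle⟩ := exists_subpartition_ent_add_le 𝒳 hp0 hG.connected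
    (fun i j hij => csInf_le hfin.bddBelow ⟨i, j, hij, rfl⟩) hpart (π.card - 1) (by omega)
  obtain rfl : S = π := Finset.eq_of_subset_of_card_le hS (by omega)
  have hpos : (0 : ℝ) < S.card - 1 := by
    have : (2 : ℝ) ≤ S.card := by exact_mod_cast hk
    linarith
  rw [hpart.2.2, Nat.cast_sub (by omega), Nat.cast_one] at hle
  rw [cI, ← div_eq_inv_mul, le_div_iff₀ hpos]
  linarith

end MCT
end
end

section
/- Let X_1, …, X_m form a Markov chain on a tree G = (M, E) and let π = (π_1, …, π_k), k ≥ 3, be a partition of M. Suppose A is a nonempty proper subset of the atom π_1 such that some vertex j ∈ M \ π_1 separates A and π_1 \ A in G (every path from a vertex of A to a vertex of π_1 \ A passes through j), and let π_u, u ≠ 1, be the atom containing j. Define the (k−1)-partition π' = (π_1 ∪ π_u, (π_v)_{v≠1, v≠u}) and the (k+1)-partition π'' = (π_1 \ A, A, π_u, (π_v)_{v≠1, v≠u}). Then I(π) ≥ min{ I(π'), I(π'') }. -/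
open Classical
open scoped BigOperators

noncomputable section

namespace MCT

variable {m : ℕ}

section Entropy

variable (𝒳 : Fin m → Type) [∀ i, Fintype (𝒳 i)] (p : (∀ i, 𝒳 i) → ℝ)

/-- The probability that the coordinates in `A` agree with those of `x`. -/
def cylProb (A : Finset (Fin m)) (x : ∀ i, 𝒳 i) : ℝ :=
  ∑ y : (i : Fin m) → 𝒳 i, if ∀ i ∈ A, y i = x i then p y else 0

variable {𝒳 p}

theorem cylProb_congr {A : Finset (Fin m)} {x y : ∀ i, 𝒳 i} (h : ∀ i ∈ A, x i = y i) :
    cylProb 𝒳 p A x = cylProb 𝒳 p A y := by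
  unfold cylProb
  refine Finset.sum_congr rfl fun z _ => if_congr ?_ rfl rfl
  exact forall₂_congr fun i hi => by rw [h i hi]

theorem le_cylProb (hp0 : ∀ x, 0 ≤ p x) (A : Finset (Fin m)) (x : ∀ i, 𝒳 i) :
    p x ≤ cylProb 𝒳 p A x := by
  have := Finset.single_le_sum
    (f := fun y : ∀ i, 𝒳 i => if ∀ i ∈ A, y i = x i then p y else 0)
    (fun y _ => by split_ifs <;> simp [hp0]) (Finset.mem_univ x)
  simpa [cylProb] using this

theorem cylProb_nonneg (hp0 : ∀ x, 0 ≤ p x) (A : Finset (Fin m)) (x : ∀ i, 𝒳 i) :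
    0 ≤ cylProb 𝒳 p A x :=
  (hp0 x).trans (le_cylProb hp0 A x)

variable (𝒳 p) in
theorem ent_eq_sum_cylProb (A : Finset (Fin m)) :
    ent 𝒳 p A = -∑ x, p x * Real.logb 2 (cylProb 𝒳 p A x) := by
  have hmarg : ∀ x : ∀ i, 𝒳 i, marg 𝒳 p A (fun i => x i.1) = cylProb 𝒳 p A x := by
    intro x
    simp [marg, cylProb]
  unfold ent
  congr 1
  calc ∑ y, marg 𝒳 p A y * Real.logb 2 (marg 𝒳 p A y)
      = ∑ y : (i : A) → 𝒳 i.1, ∑ x : ∀ i, 𝒳 i,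
          if y = (fun i : A => x i.1) then p x * Real.logb 2 (marg 𝒳 p A y) else 0 := by
        refine Finset.sum_congr rfl fun y _ => ?_
        conv_lhs => rw [marg, Finset.sum_mul]
        refine Finset.sum_congr rfl fun x _ => ?_
        rw [ite_mul, zero_mul]
        exact if_congr ⟨fun h => funext fun i => (h i).symm, fun h i => (congrFun h i).symm⟩
          rfl rfl
    _ = ∑ x, p x * Real.logb 2 (cylProb 𝒳 p A x) := by
        rw [Finset.sum_comm]
        refine Finset.sum_congr rfl fun x _ => ?_
        rw [Finset.sum_ite_eq' Finset.univ, if_pos (Finset.mem_univ _), hmarg]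

theorem sum_div_cylProb_le_one (A : Finset (Fin m)) (z : ∀ i, 𝒳 i) :
    ∑ x, (if ∀ i ∈ A, x i = z i then p x / cylProb 𝒳 p A x else 0) ≤ 1 := by
  have : ∑ x, (if ∀ i ∈ A, x i = z i then p x / cylProb 𝒳 p A x else 0)
      = cylProb 𝒳 p A z / cylProb 𝒳 p A z := by
    conv_rhs => rw [cylProb, Finset.sum_div]
    refine Finset.sum_congr rfl fun x _ => ?_
    split_ifs with h
    · rw [cylProb_congr h]; rfl
    · simp
  rw [this]
  exact div_self_le_one _

theorem sum_mul_cylProb_ratio_le_one (hp0 : ∀ x, 0 ≤ p x) (hp1 : ∑ x, p x = 1)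
    (A B : Finset (Fin m)) :
    ∑ x, p x * (cylProb 𝒳 p A x * cylProb 𝒳 p B x /
      (cylProb 𝒳 p (A ∪ B) x * cylProb 𝒳 p (A ∩ B) x)) ≤ 1 := by
  have hterm : ∀ a b : ∀ i, 𝒳 i,
      ∑ x, (if (∀ i ∈ A, a i = x i) ∧ (∀ i ∈ B, b i = x i) then
        p a * p b * p x / (cylProb 𝒳 p (A ∪ B) x * cylProb 𝒳 p (A ∩ B) x) else 0)
      ≤ if ∀ i ∈ A ∩ B, b i = a i then p a * (p b / cylProb 𝒳 p (A ∩ B) b) else 0 := by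
    intro a b
    split_ifs with hab
    · let z : ∀ i, 𝒳 i := fun i => if i ∈ A then a i else b i
      have hz : ∀ x : ∀ i, 𝒳 i, ((∀ i ∈ A, a i = x i) ∧ (∀ i ∈ B, b i = x i)) ↔
          ∀ i ∈ A ∪ B, x i = z i := by
        intro x
        constructor
        · rintro ⟨h1, h2⟩ i hi
          by_cases hA : i ∈ A
          · simp [z, hA, h1 i hA]
          · simp [z, hA, h2 i ((Finset.mem_union.1 hi).resolve_left hA)]
        · intro h
          refine ⟨fun i hi => ?_, fun i hi => ?_⟩
          · simp [h i (Finset.mem_union_left _ hi), z, hi]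
          · rw [h i (Finset.mem_union_right _ hi)]
            by_cases hA : i ∈ A
            · simp [z, hA, hab i (Finset.mem_inter.2 ⟨hA, hi⟩)]
            · simp [z, hA]
      have heq : ∑ x, (if (∀ i ∈ A, a i = x i) ∧ (∀ i ∈ B, b i = x i) then
          p a * p b * p x / (cylProb 𝒳 p (A ∪ B) x * cylProb 𝒳 p (A ∩ B) x) else 0)
          = p a * (p b / cylProb 𝒳 p (A ∩ B) b) *
            ∑ x, (if ∀ i ∈ A ∪ B, x i = z i then p x / cylProb 𝒳 p (A ∪ B) x else 0) := by
        rw [Finset.mul_sum]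
        refine Finset.sum_congr rfl fun x _ => ?_
        rw [mul_ite, mul_zero, ← if_congr (hz x) rfl rfl]
        split_ifs with h
        · rw [cylProb_congr (A := A ∩ B) (x := b) (y := x)
            fun i hi => h.2 i (Finset.mem_inter.1 hi).2]
          ring
        · rfl
      rw [heq]
      exact mul_le_of_le_one_right
        (mul_nonneg (hp0 a) (div_nonneg (hp0 b) (cylProb_nonneg hp0 _ _)))
        (sum_div_cylProb_le_one _ z)
    · refine (Finset.sum_eq_zero fun x _ => if_neg ?_).le
      rintro ⟨h1, h2⟩
      refine hab fun i hi => ?_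
      rw [h1 i (Finset.mem_inter.1 hi).1, h2 i (Finset.mem_inter.1 hi).2]
  calc ∑ x, p x * (cylProb 𝒳 p A x * cylProb 𝒳 p B x /
        (cylProb 𝒳 p (A ∪ B) x * cylProb 𝒳 p (A ∩ B) x))
      = ∑ x, ∑ a, ∑ b, (if (∀ i ∈ A, a i = x i) ∧ (∀ i ∈ B, b i = x i) then
        p a * p b * p x / (cylProb 𝒳 p (A ∪ B) x * cylProb 𝒳 p (A ∩ B) x) else 0) := by
        refine Finset.sum_congr rfl fun x _ => ?_
        conv_lhs => rw [cylProb, cylProb, Finset.sum_mul_sum, Finset.sum_div, Finset.mul_sum]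
        refine Finset.sum_congr rfl fun a _ => ?_
        rw [Finset.sum_div, Finset.mul_sum]
        refine Finset.sum_congr rfl fun b _ => ?_
        by_cases h1 : ∀ i ∈ A, a i = x i
        · by_cases h2 : ∀ i ∈ B, b i = x i
          · rw [if_pos h1, if_pos h2, if_pos ⟨h1, h2⟩]; ring
          · rw [if_neg h2, if_neg (mt And.right h2)]; simp
        · rw [if_neg h1, if_neg (mt And.left h1)]; simp
    _ = ∑ a, ∑ b, ∑ x, (if (∀ i ∈ A, a i = x i) ∧ (∀ i ∈ B, b i = x i) then
        p a * p b * p x / (cylProb 𝒳 p (A ∪ B) x * cylProb 𝒳 p (A ∩ B) x) else 0) := by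
        rw [Finset.sum_comm]
        exact Finset.sum_congr rfl fun a _ => Finset.sum_comm
    _ ≤ ∑ a, ∑ b, (if ∀ i ∈ A ∩ B, b i = a i then
        p a * (p b / cylProb 𝒳 p (A ∩ B) b) else 0) :=
        Finset.sum_le_sum fun a _ => Finset.sum_le_sum fun b _ => hterm a b
    _ ≤ ∑ a, p a := by
        refine Finset.sum_le_sum fun a _ => ?_
        simp_rw [← mul_ite_zero, ← Finset.mul_sum]
        exact mul_le_of_le_one_right (hp0 a) (sum_div_cylProb_le_one _ a)
    _ = 1 := hp1

/-- Shannon entropy is submodular. -/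
theorem ent_union_add_ent_inter_le (hp0 : ∀ x, 0 ≤ p x) (hp1 : ∑ x, p x = 1)
    (A B : Finset (Fin m)) :
    ent 𝒳 p (A ∪ B) + ent 𝒳 p (A ∩ B) ≤ ent 𝒳 p A + ent 𝒳 p B := by
  have hlog2 : 0 < Real.log 2 := Real.log_pos one_lt_two
  have hpt : ∀ x, p x - p x * (cylProb 𝒳 p A x * cylProb 𝒳 p B x /
        (cylProb 𝒳 p (A ∪ B) x * cylProb 𝒳 p (A ∩ B) x)) ≤
      p x * (Real.log (cylProb 𝒳 p (A ∪ B) x) + Real.log (cylProb 𝒳 p (A ∩ B) x)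
        - Real.log (cylProb 𝒳 p A x) - Real.log (cylProb 𝒳 p B x)) := by
    intro x
    rcases (hp0 x).eq_or_lt with h | h
    · simp [← h]
    · have hpos : ∀ C, 0 < cylProb 𝒳 p C x := fun C => h.trans_le (le_cylProb hp0 C x)
      have hA := hpos A
      have hB := hpos B
      have hU := hpos (A ∪ B)
      have hI := hpos (A ∩ B)
      have key := Real.log_le_sub_one_of_pos (div_pos (mul_pos hA hB) (mul_pos hU hI))
      rw [Real.log_div (mul_pos hA hB).ne' (mul_pos hU hI).ne', Real.log_mul hA.ne' hB.ne',
        Real.log_mul hU.ne' hI.ne'] at key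
      rw [← mul_one_sub]
      exact mul_le_mul_of_nonneg_left (by linarith) h.le
  have hsum := Finset.sum_le_sum fun x (_ : x ∈ Finset.univ) => hpt x
  rw [Finset.sum_sub_distrib, hp1] at hsum
  have hge := (sub_nonneg.2 (sum_mul_cylProb_ratio_le_one hp0 hp1 A B)).trans hsum
  have hfin : ent 𝒳 p A + ent 𝒳 p B - (ent 𝒳 p (A ∪ B) + ent 𝒳 p (A ∩ B)) =
      (∑ x, p x * (Real.log (cylProb 𝒳 p (A ∪ B) x) + Real.log (cylProb 𝒳 p (A ∩ B) x)
        - Real.log (cylProb 𝒳 p A x) - Real.log (cylProb 𝒳 p B x))) / Real.log 2 := by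
    simp only [ent_eq_sum_cylProb, Real.logb, mul_sub, mul_add, Finset.sum_sub_distrib,
      Finset.sum_add_distrib, ← mul_div_assoc, ← Finset.sum_div]
    ring
  exact sub_nonneg.1 (hfin ▸ div_nonneg hge hlog2.le)

end Entropy

theorem mem_side {V : Type*} [Fintype V] {G : SimpleGraph V} {i j k : V} :
    k ∈ side G i j ↔ (G.deleteEdges {s(i, j)}).Reachable k i := by
  simp [side]

section Submodular

variable {V : Type*} [DecidableEq V] {h : Finset V → ℝ}

/-- The conditional gain of a submodular function decreases with the conditioning set. -/
theorem submodular_insert_le (hsub : ∀ A B, h (A ∪ B) + h (A ∩ B) ≤ h A + h B)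
    {S T : Finset V} (hST : S ⊆ T) {v : V} (hv : v ∉ T) :
    h (insert v T) + h S ≤ h (insert v S) + h T := by
  have := hsub (insert v S) T
  rwa [Finset.insert_union, Finset.union_eq_right.2 hST, Finset.insert_inter_of_notMem hv,
    Finset.inter_eq_left.2 hST] at this

/-- Mutual information is monotone in its second argument. -/
theorem submodular_mutual_mono_right (hsub : ∀ A B, h (A ∪ B) + h (A ∩ B) ≤ h A + h B)
    {A B C : Finset V} (hBC : B ⊆ C) (hAC : Disjoint A C) :
    h A + h B - h (A ∪ B) ≤ h A + h C - h (A ∪ C) := by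
  have := hsub (A ∪ B) C
  rw [Finset.union_assoc, Finset.union_eq_right.2 hBC, Finset.union_inter_distrib_right,
    Finset.disjoint_iff_inter_eq_empty.1 hAC, Finset.empty_union,
    Finset.inter_eq_left.2 hBC] at this
  linarith

/-- Conditional independence given `j` passes to subsets. -/
theorem submodular_condIndep_mono (hsub : ∀ A B, h (A ∪ B) + h (A ∩ B) ≤ h A + h B)
    {A B A' B' : Finset V} {j : V} (hA : A ⊆ A') (hB : B ⊆ B') (hAB : Disjoint A' B')
    (hjA : j ∉ A') (hjB : j ∉ B')
    (hind : h (insert j A') + h (insert j B') ≤ h (insert j (A' ∪ B')) + h {j}) :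
    h (insert j A) + h (insert j B) ≤ h (insert j (A ∪ B)) + h {j} := by
  have h1 := hsub (insert j (A ∪ B)) (insert j A')
  have h2 := hsub (insert j (A' ∪ B)) (insert j B')
  have e1 : insert j (A ∪ B) ∪ insert j A' = insert j (A' ∪ B) := by grind
  have e2 : insert j (A ∪ B) ∩ insert j A' = insert j A := by
    have := Finset.disjoint_left.1 hAB
    grind
  have e3 : insert j (A' ∪ B) ∪ insert j B' = insert j (A' ∪ B') := by grind
  have e4 : insert j (A' ∪ B) ∩ insert j B' = insert j B := by
    have := Finset.disjoint_left.1 hAB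
    grind
  rw [e1, e2] at h1
  rw [e3, e4] at h2
  linarith

variable [Fintype V]

/-- The edgewise Markov property on a tree implies that a union `C` of components of `G - j` is
conditionally independent of the remaining vertices given `j`. -/
theorem condIndep_of_edge_markov (hsub : ∀ A B, h (A ∪ B) + h (A ∩ B) ≤ h A + h B)
    {G : SimpleGraph V} (hG : G.IsTree)
    (hmarkov : ∀ u v, G.Adj u v →
      h {u, v} + h (side G u v) = h (insert v (side G u v)) + h {u})
    {j : V} {C : Finset V} (hjC : j ∉ C)
    (hC : ∀ u v, G.Adj u v → u ≠ j → v ≠ j → u ∈ C → v ∈ C) :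
    h (insert j C) + h Cᶜ ≤ h Finset.univ + h {j} := by
  let good : Finset V → Prop := fun S => j ∈ S ∧
    (∀ s ∈ S, ∃ w : G.Walk s j, ∀ x ∈ w.support, x ∈ S) ∧
    h (S ∩ insert j C) + h (S \ C) ≤ h S + h {j}
  have hstart : good {j} := by
    refine ⟨by simp, ?_, ?_⟩
    · intro s hs
      obtain rfl := Finset.mem_singleton.1 hs
      exact ⟨.nil, by simp⟩
    · have e1 : {j} ∩ insert j C = {j} := by grind
      have e2 : {j} \ C = {j} := by grind
      rw [e1, e2]
  obtain ⟨S, hS, hmax⟩ := Finset.exists_max_image (Finset.univ.filter good) Finset.card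
    ⟨{j}, by simpa using hstart⟩
  obtain ⟨hjS, hconn, hineq⟩ := (Finset.mem_filter.1 hS).2
  have hSuniv : S = Finset.univ := by
    by_contra hne
    obtain ⟨y, hy⟩ : ∃ y, y ∉ S := by
      by_contra! hall
      exact hne (Finset.eq_univ_iff_forall.2 hall)
    obtain ⟨w⟩ := hG.connected j y
    obtain ⟨d, -, hu, hv⟩ := w.exists_boundary_dart (S : Set V) hjS hy
    obtain ⟨⟨u, v⟩, huv⟩ := d
    simp only [Finset.mem_coe] at hu hv huv
    have hvside : v ∉ side G u v := by
      intro hmem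
      have hbridge := SimpleGraph.isAcyclic_iff_forall_adj_isBridge.1 hG.isAcyclic huv
      rw [SimpleGraph.isBridge_iff] at hbridge
      exact hbridge (mem_side.1 hmem).symm
    have hSside : S ⊆ side G u v := by
      intro s hs
      refine mem_side.2 ?_
      obtain ⟨w₁, hw₁⟩ := hconn s hs
      obtain ⟨w₂, hw₂⟩ := hconn u hu
      refine ⟨(w₁.append w₂.reverse).toDeleteEdges _ ?_⟩
      rintro e he rfl
      have hvw := SimpleGraph.Walk.snd_mem_support_of_mem_edges _ he
      rw [SimpleGraph.Walk.mem_support_append_iff, SimpleGraph.Walk.support_reverse,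
        List.mem_reverse] at hvw
      exact hv (hvw.elim (hw₁ v) (hw₂ v))
    have hgain : h {u, v} + h S ≤ h (insert v S) + h {u} := by
      have := submodular_insert_le hsub hSside hvside
      have := hmarkov u v huv
      linarith
    have hgain' : ∀ P ⊆ S, u ∈ P → h (insert v P) + h S ≤ h (insert v S) + h P := by
      intro P hP huP
      have := submodular_insert_le hsub (Finset.singleton_subset_iff.2 huP)
        (fun hvP => hv (hP hvP))
      rw [Finset.pair_comm v u] at this
      linarith
    have hvj : v ≠ j := fun e => hv (e ▸ hjS)
    have hgood : good (insert v S) := by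
      refine ⟨Finset.mem_insert_of_mem hjS, ?_, ?_⟩
      · intro s hs
        rcases Finset.mem_insert.1 hs with rfl | hs
        · obtain ⟨w, hw⟩ := hconn u hu
          refine ⟨.cons huv.symm w, fun x hx => ?_⟩
          rw [SimpleGraph.Walk.support_cons, List.mem_cons] at hx
          exact Finset.mem_insert.2 (hx.imp_right (hw x))
        · obtain ⟨w, hw⟩ := hconn s hs
          exact ⟨w, fun x hx => Finset.mem_insert_of_mem (hw x hx)⟩
      · by_cases hvC : v ∈ C
        · have e1 : insert v S ∩ insert j C = insert v (S ∩ insert j C) := by grind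
          have e2 : insert v S \ C = S \ C := by grind
          have huP : u ∈ S ∩ insert j C := by
            have := hC v u huv.symm hvj
            grind
          have := hgain' _ Finset.inter_subset_left huP
          rw [e1, e2]
          linarith
        · have e1 : insert v S ∩ insert j C = S ∩ insert j C := by grind
          have e2 : insert v S \ C = insert v (S \ C) := by grind
          have huP : u ∈ S \ C := by
            have := fun huj => hC u v huv huj hvj
            grind
          have := hgain' _ Finset.sdiff_subset huP
          rw [e1, e2]
          linarith
    have := hmax _ (Finset.mem_filter.2 ⟨Finset.mem_univ _, hgood⟩)
    rw [Finset.card_insert_of_notMem hv] at this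
    omega
  rw [hSuniv, Finset.univ_inter, ← Finset.compl_eq_univ_sdiff] at hineq
  exact hineq

/-- On a tree with the edgewise Markov property, sets separated by `j` are conditionally
independent given `j`. -/
theorem condIndep_of_separated (hsub : ∀ A B, h (A ∪ B) + h (A ∩ B) ≤ h A + h B)
    {G : SimpleGraph V} (hG : G.IsTree)
    (hmarkov : ∀ u v, G.Adj u v →
      h {u, v} + h (side G u v) = h (insert v (side G u v)) + h {u})
    {j : V} {A B : Finset V} (hjA : j ∉ A) (hjB : j ∉ B)
    (hsep : ∀ a ∈ A, ∀ b ∈ B, ∀ w : G.Walk a b, j ∈ w.support) :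
    h (insert j A) + h (insert j B) ≤ h (insert j (A ∪ B)) + h {j} := by
  let C : Finset V := Finset.univ.filter fun x => ∃ a ∈ A, ∃ w : G.Walk a x, j ∉ w.support
  have hmem : ∀ x, x ∈ C ↔ ∃ a ∈ A, ∃ w : G.Walk a x, j ∉ w.support := by simp [C]
  have hjC : j ∉ C := by
    rw [hmem]
    rintro ⟨a, -, w, hw⟩
    exact hw w.end_mem_support
  have hCclosed : ∀ u v, G.Adj u v → u ≠ j → v ≠ j → u ∈ C → v ∈ C := by
    intro u v huv _ hvj hu
    obtain ⟨a, ha, w, hw⟩ := (hmem u).1 hu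
    refine (hmem v).2 ⟨a, ha, w.concat huv, ?_⟩
    rw [SimpleGraph.Walk.support_concat]
    simp [hw, hvj.symm]
  have hAC : A ⊆ C := fun a ha => (hmem a).2
    ⟨a, ha, .nil, by simpa using fun e : j = a => hjA (e ▸ ha)⟩
  have hBC : B ⊆ Cᶜ.erase j := by
    intro b hb
    refine Finset.mem_erase.2 ⟨fun e => hjB (e ▸ hb), Finset.mem_compl.2 fun hbC => ?_⟩
    obtain ⟨a, ha, w, hw⟩ := (hmem b).1 hbC
    exact hw (hsep a ha b hb w)
  have hind := condIndep_of_edge_markov hsub hG hmarkov hjC hCclosed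
  have hins : insert j (Cᶜ.erase j) = Cᶜ := Finset.insert_erase (Finset.mem_compl.2 hjC)
  refine submodular_condIndep_mono hsub hAC hBC
    (disjoint_compl_right.mono_right (Finset.erase_subset _ _)) hjC
    (Finset.notMem_erase _ _) ?_
  rwa [← Finset.union_insert, hins, Finset.union_compl]

end Submodular

theorem IsMCT.ent_edge {𝒳 : Fin m → Type} [∀ i, Fintype (𝒳 i)] {G : SimpleGraph (Fin m)}
    {p : (∀ i, 𝒳 i) → ℝ} (hMCT : IsMCT 𝒳 G p) (u v : Fin m) (huv : G.Adj u v) :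
    ent 𝒳 p {u, v} + ent 𝒳 p (side G u v) = ent 𝒳 p (insert v (side G u v)) + ent 𝒳 p {u} := by
  have hu : u ∈ side G u v := mem_side.2 (.refl _)
  have hcmi := hMCT u v huv
  have e1 : {v} ∪ {u} = ({u, v} : Finset (Fin m)) := by grind
  have e2 : (side G u v).erase u ∪ {u} = side G u v := by grind
  have e3 : {v} ∪ (side G u v).erase u ∪ {u} = insert v (side G u v) := by grind
  rw [cmi, e1, e2, e3] at hcmi
  linarith

/-- Merging changes `T` to `T - a` and splitting changes it to `T + b`; if `b ≤ a`, one of the two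
normalized values does not exceed the original one. -/
theorem min_merge_split_le {k T a b : ℝ} (hk : 3 ≤ k) (hab : b ≤ a) :
    min ((k - 1 - 1)⁻¹ * (T - a)) ((k + 1 - 1)⁻¹ * (T + b)) ≤ (k - 1)⁻¹ * T := by
  have h1 : 0 < k - 1 := by linarith
  have h2 : 0 < k - 1 - 1 := by linarith
  have h3 : 0 < k + 1 - 1 := by linarith
  obtain ⟨t, ht⟩ : ∃ t, t = (k - 1)⁻¹ * T := ⟨_, rfl⟩
  have hT : T = (k - 1) * t := by rw [ht, mul_inv_cancel_left₀ h1.ne']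
  rw [← ht, min_le_iff, inv_mul_le_iff₀ h2, inv_mul_le_iff₀ h3, hT]
  by_contra! hcon
  linarith [hcon.1, hcon.2]

/-- For an MCT and a partition π with k ≥ 3 atoms, a disconnected piece A of
atom π₁ separated from π₁ \\ A by a vertex j lying in another atom πᵤ: merging π₁ with πᵤ
(partition π') or splitting off A (partition π'') gives min{I(π'), I(π'')} ≤ I(π). -/
theorem cI_ge_min_merge_split
    {m : ℕ} (hm : 2 ≤ m) (𝒳 : Fin m → Type) [∀ i, Fintype (𝒳 i)]
    (p : (∀ i, 𝒳 i) → ℝ) (hp0 : ∀ x, 0 ≤ p x) (hp1 : ∑ x, p x = 1)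
    (G : SimpleGraph (Fin m)) (hG : G.IsTree) (hMCT : IsMCT 𝒳 G p)
    (π : Finset (Finset (Fin m))) (hpart : IsPartition π) (hk : 3 ≤ π.card)
    (π₁ : Finset (Fin m)) (hπ₁ : π₁ ∈ π)
    (A : Finset (Fin m)) (hA : A ⊆ π₁) (hAne : A.Nonempty) (hAprop : A ≠ π₁)
    (j : Fin m) (hj : j ∉ π₁)
    (hsep : ∀ a ∈ A, ∀ b ∈ π₁ \ A, ∀ w : G.Walk a b, j ∈ w.support)
    (πu : Finset (Fin m)) (hπu : πu ∈ π) (hπu1 : πu ≠ π₁) (hjπu : j ∈ πu) :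
    min (cI 𝒳 p (insert (π₁ ∪ πu) ((π.erase π₁).erase πu)))
        (cI 𝒳 p (insert (π₁ \ A) (insert A (π.erase π₁))))
      ≤ cI 𝒳 p π := by
  have hsub := ent_union_add_ent_inter_le (𝒳 := 𝒳) hp0 hp1
  obtain ⟨hne, hdisj, -⟩ := hpart
  have hd : Disjoint π₁ πu := hdisj hπ₁ hπu hπu1.symm
  have hAB : A ∪ π₁ \ A = π₁ := Finset.union_sdiff_of_subset hA
  have hBne : (π₁ \ A).Nonempty :=
    Finset.sdiff_nonempty.2 fun hle => hAprop (Finset.Subset.antisymm hA hle)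
  have hjA : j ∉ A := fun hjA => hj (hA hjA)
  have hjB : j ∉ π₁ \ A := fun hjB => hj (Finset.mem_sdiff.1 hjB).1
  -- data processing: `I(A ∧ π₁ \ A) ≤ I(A ∧ j) ≤ I(π₁ ∧ πu)`
  have hdp : ent 𝒳 p A + ent 𝒳 p (π₁ \ A) - ent 𝒳 p π₁ ≤
      ent 𝒳 p π₁ + ent 𝒳 p πu - ent 𝒳 p (π₁ ∪ πu) := by
    have hci := condIndep_of_separated hsub hG hMCT.ent_edge hjA hjB hsep
    have hdAB : Disjoint A (insert j (π₁ \ A)) :=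
      Finset.disjoint_insert_right.2 ⟨hjA, Finset.disjoint_sdiff⟩
    have h1 := submodular_mutual_mono_right hsub (Finset.subset_insert j (π₁ \ A)) hdAB
    have h2 := submodular_mutual_mono_right hsub (Finset.singleton_subset_iff.2 hjπu)
      (hd.mono_left hA)
    have h3 := submodular_mutual_mono_right hsub hA hd.symm
    rw [Finset.union_insert, hAB] at h1
    rw [hAB] at hci
    rw [Finset.union_comm A {j}, ← Finset.insert_eq] at h2
    rw [Finset.union_comm πu A, Finset.union_comm πu π₁] at h3
    linarith
  have hnot_mem : ∀ s : Finset (Fin m), s.Nonempty → s ⊆ π₁ → s ∉ π.erase π₁ := by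
    intro s hs hsub₁ hmem
    obtain ⟨hs₁, hsπ⟩ := Finset.mem_erase.1 hmem
    obtain ⟨x, hx⟩ := hs
    exact Finset.disjoint_left.1 (hdisj hsπ hπ₁ hs₁) hx (hsub₁ hx)
  have hπu' : πu ∈ π.erase π₁ := Finset.mem_erase.2 ⟨hπu1, hπu⟩
  have hmerge : π₁ ∪ πu ∉ (π.erase π₁).erase πu := by
    intro hmem
    obtain ⟨hu, hmem⟩ := Finset.mem_erase.1 hmem
    exact Finset.disjoint_left.1 (hdisj (Finset.mem_erase.1 hmem).2 hπu hu)
      (Finset.mem_union_right _ hjπu) hjπu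
  have hA_mem : A ∉ π.erase π₁ := hnot_mem A hAne hA
  have hB_mem : π₁ \ A ∉ insert A (π.erase π₁) := by
    rw [Finset.mem_insert, not_or]
    refine ⟨fun e => ?_, hnot_mem _ hBne Finset.sdiff_subset⟩
    obtain ⟨x, hx⟩ := hAne
    exact (Finset.mem_sdiff.1 (e.symm ▸ hx : x ∈ π₁ \ A)).2 hx
  have hc₁ := Finset.card_erase_add_one hπ₁
  have hc₂ := Finset.card_erase_add_one hπu'
  have hs₁ := Finset.add_sum_erase π (ent 𝒳 p) hπ₁
  have hs₂ := Finset.add_sum_erase (π.erase π₁) (ent 𝒳 p) hπu'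
  have hk' : (3 : ℝ) ≤ π.card := by exact_mod_cast hk
  have key := min_merge_split_le (T := (∑ a ∈ π, ent 𝒳 p a) - ent 𝒳 p Finset.univ) hk' hdp
  unfold cI
  convert key using 3
  · rw [Finset.card_insert_of_notMem hmerge, hc₂, ← hc₁]
    push_cast
    ring
  · rw [Finset.sum_insert hmerge]
    linarith
  · rw [Finset.card_insert_of_notMem hB_mem, Finset.card_insert_of_notMem hA_mem, hc₁]
    push_cast
    ring
  · rw [Finset.sum_insert hB_mem, Finset.sum_insert hA_mem]
    linarith

end MCT
end
end
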